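/- arXiv:2411.18569 — 2 statements merged into one kernel-verified Lean document; each statement's English description precedes it below -/
import Mathlib

section
/- (One-dimensional reduction for top-k inference.) Fix k with 1 ≤ k ≤ m. Let X ∈ ℝ^m have pairwise distinct coordinates with top-k indices î_(1), …, î_(k). Fix 𝐫 = (r_{î_(1)}, …, r_{î_(k)}) ∈ ℝ^k. For r ∈ ℝ define θ̃^r ∈ ℝ^m by θ̃^r_j = X_j − r for j ∈ {î_(1), …, î_(k)} and θ̃^r_j = min{ (2/3)X_j + (1/3)(X_{î_(k)} − r), X_{î_(k)} − r } otherwise. If (X_{î_(1)} − r_{î_(1)}, …, X_{î_(k)} − r_{î_(k)}) ∈ Ĉ^α_{î_(1),…,î_(k)} := { (θ_{î_(1)},…,θ_{î_(k)}) : θ ∈ ℝ^m, X ∈ A_α(θ) }, then |r_{î_(j₀)}| ≤ r_α( θ̃^{|r_{î_(j₀)}|} ), where j₀ = argmax_{j∈[k]} |r_{î_(j)}|. -/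
open Set

noncomputable section

/-- The `k`-th largest coordinate of `θ`. -/
def kth (m k : ℕ) (θ : Fin m → ℝ) : ℝ :=
  sSup {t : ℝ | k ≤ Set.ncard {j : Fin m | t ≤ θ j}}

/-- Top-`k` suboptimality gap `Δ^{(k)}_j(θ) = max{θ_(k) − θ_j, 0}`. -/
def gapk (m k : ℕ) (θ : Fin m → ℝ) (j : Fin m) : ℝ := max (kth m k θ - θ j) 0

/-- Top-`k` active radius `r_α(θ) = min {r ≥ 0 : 𝐒((max{r, Δ^{(k)}_j(θ)/2})_j) ≤ α}`. -/
def rAk (m k : ℕ) (S : (Fin m → ℝ) → ℝ) (α : ℝ) (θ : Fin m → ℝ) : ℝ :=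
  sInf {r : ℝ | 0 ≤ r ∧ S (fun j => max r (gapk m k θ j / 2)) ≤ α}

/-- Top-`k` acceptance-region membership: `x ∈ A_α(θ)`. -/
def acceptk (m k : ℕ) (S : (Fin m → ℝ) → ℝ) (α : ℝ) (θ x : Fin m → ℝ) : Prop :=
  ∀ j, |x j - θ j| ≤ max (rAk m k S α θ) (gapk m k θ j / 2)

/-- The vector `θ̃^r`: `θ̃^r_j = X_j − r` on the top-`k` indices and
`θ̃^r_j = min{(2/3)X_j + (1/3)(X_{î_(k)} − r), X_{î_(k)} − r}` otherwise
(`xk` stands for `X_{î_(k)}`). -/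
def thetaTil (m k : ℕ) (X : Fin m → ℝ) (ihat : Fin k → Fin m) (xk r : ℝ) :
    Fin m → ℝ :=
  fun j =>
    if ∃ a, ihat a = j then X j - r
    else min (2 / 3 * X j + 1 / 3 * (xk - r)) (xk - r)

lemma kth_ge_of {m k : ℕ} (hk : 0 < k) (θ : Fin m → ℝ) (t : ℝ)
    (h : k ≤ Set.ncard {j : Fin m | t ≤ θ j}) : t ≤ kth m k θ := by
  refine le_csSup ?_ h
  obtain ⟨B, hB⟩ := (Set.finite_range θ).bddAbove
  refine ⟨B, fun s hs => ?_⟩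
  have hs' : k ≤ Set.ncard {j : Fin m | s ≤ θ j} := hs
  obtain ⟨j, hj⟩ := Set.nonempty_of_ncard_ne_zero (by omega : Set.ncard {j : Fin m | s ≤ θ j} ≠ 0)
  exact le_trans hj (hB ⟨j, rfl⟩)

lemma kth_attained {m k : ℕ} (hkm : k ≤ m) (θ : Fin m → ℝ) :
    k ≤ Set.ncard {j : Fin m | kth m k θ ≤ θ j} := by
  have hne : {t : ℝ | k ≤ Set.ncard {j : Fin m | t ≤ θ j}}.Nonempty := by
    obtain ⟨B, hB⟩ := (Set.finite_range θ).bddBelow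
    refine ⟨B, ?_⟩
    have : {j : Fin m | B ≤ θ j} = Set.univ := by
      ext j; simpa using hB ⟨j, rfl⟩
    simp only [Set.mem_ofPred_eq, this, Set.ncard_univ]
    simpa using hkm
  have hev : ∀ᶠ t in nhdsWithin (kth m k θ) (Set.Iio (kth m k θ)),
      ∀ j, t ≤ θ j → kth m k θ ≤ θ j := by
    rw [Filter.eventually_all]
    intro j
    by_cases hj : kth m k θ ≤ θ j
    · exact Filter.Eventually.of_forall fun _ _ => hj
    · have h2 : ∀ᶠ t in nhdsWithin (kth m k θ) (Set.Iio (kth m k θ)), θ j < t :=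
        (lt_mem_nhds (not_le.mp hj)).filter_mono nhdsWithin_le_nhds
      filter_upwards [h2] with t ht h
      exact absurd h (not_le.mpr ht)
  obtain ⟨t, ht, htl⟩ := (hev.and self_mem_nhdsWithin).exists
  obtain ⟨s, hs, hts⟩ := exists_lt_of_lt_csSup hne htl
  have hs' : k ≤ Set.ncard {j : Fin m | s ≤ θ j} := hs
  refine hs'.trans (Set.ncard_le_ncard ?_ (Set.toFinite _))
  intro j hj
  exact ht j (hts.le.trans hj)

lemma S_anti {m : ℕ} (S : (Fin m → ℝ) → ℝ)
    (hSanti : ∀ v : Fin m → ℝ, (∀ j, 0 ≤ v j) → ∀ (j : Fin m) (a b : ℝ),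
      0 ≤ a → a < b → S (Function.update v j b) < S (Function.update v j a))
    (u w : Fin m → ℝ) (hu : ∀ j, 0 ≤ u j) (huw : ∀ j, u j ≤ w j) : S w ≤ S u := by
  have key : ∀ s : Finset (Fin m), S (fun j => if j ∈ s then w j else u j) ≤ S u := by
    intro s
    induction s using Finset.induction_on with
    | empty => simp
    | insert a s ha ih =>
      refine le_trans ?_ ih
      set v : Fin m → ℝ := fun j => if j ∈ s then w j else u j with hv
      have hv0 : ∀ j, 0 ≤ v j := by
        intro j
        simp only [hv]
        split_ifs
        · exact (hu j).trans (huw j)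
        · exact hu j
      have e1 : (fun j => if j ∈ insert a s then w j else u j) = Function.update v a (w a) := by
        ext j
        by_cases hj : j = a
        · subst hj; simp
        · simp [hj, hv]
      have e2 : v = Function.update v a (u a) := by
        ext j
        by_cases hj : j = a
        · subst hj; simp [hv, ha]
        · simp [hj]
      rw [e1]
      rcases (huw a).eq_or_lt with h | h
      · rw [← h, ← e2]
      · calc _ ≤ S (Function.update v a (u a)) := (hSanti v hv0 a _ _ (hu a) h).le
          _ = S v := by rw [← e2]
  simpa using key Finset.univ

/-- **One-dimensional reduction for top-k inference.** If
`(X_{î_(1)} − r_1, …, X_{î_(k)} − r_k) ∈ Ĉ^α_{î_(1),…,î_(k)}`, then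
`|r_{j₀}| ≤ r_α(θ̃^{|r_{j₀}|})` where `j₀ = argmax_a |r_a|`. -/
theorem topk_one_dimensional_reduction
    (m k : ℕ) (hm : 0 < m) (hk : 0 < k) (hkm : k ≤ m)
    (α : ℝ) (hα0 : 0 < α) (hα1 : α < 1)
    (S : (Fin m → ℝ) → ℝ)
    (hS0 : ∀ v : Fin m → ℝ, (∀ j, 0 ≤ v j) → 0 ≤ S v)
    (hScont : ContinuousOn S {v : Fin m → ℝ | ∀ j, 0 ≤ v j})
    (hSanti : ∀ v : Fin m → ℝ, (∀ j, 0 ≤ v j) → ∀ (j : Fin m) (a b : ℝ),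
      0 ≤ a → a < b → S (Function.update v j b) < S (Function.update v j a))
    (hSlim : ∀ ε : ℝ, 0 < ε → ∃ M : ℝ, ∀ v : Fin m → ℝ, (∀ j, M ≤ v j) → S v < ε)
    (X : Fin m → ℝ) (hXinj : Function.Injective X)
    (ihat : Fin k → Fin m) (hinj : Function.Injective ihat)
    (hdec : ∀ a b : Fin k, a < b → X (ihat b) < X (ihat a))
    (hout : ∀ j, j ∉ Set.range ihat → ∀ a, X j < X (ihat a))
    (r : Fin k → ℝ) (j0 : Fin k) (hj0 : ∀ a, |r a| ≤ |r j0|)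
    (hmem : ∃ θ : Fin m → ℝ, acceptk m k S α θ X ∧
      ∀ a, θ (ihat a) = X (ihat a) - r a) :
    |r j0| ≤ rAk m k S α
      (thetaTil m k X ihat (X (ihat ⟨k - 1, Nat.sub_lt hk Nat.one_pos⟩)) |r j0|) := by
  obtain ⟨θ, hacc, hθ⟩ := hmem
  set R := |r j0| with hR
  set last : Fin k := ⟨k - 1, Nat.sub_lt hk Nat.one_pos⟩ with hlast
  set xk := X (ihat last) with hxk
  have hxk_le : ∀ a, xk ≤ X (ihat a) := by
    intro a
    have hal : a ≤ last := by
      rw [Fin.le_def]; have := a.2; simp only [hlast]; omega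
    rcases hal.eq_or_lt with h | h
    · rw [h]
    · exact (hdec a last h).le
  have hcard : (Set.range ihat).ncard = k := by
    rw [← Set.image_univ, Set.ncard_image_of_injective _ hinj, Set.ncard_univ]; simp
  have hr0 : 0 ≤ rAk m k S α θ := Real.sInf_nonneg fun x hx => hx.1
  have hgap0 : ∀ (η : Fin m → ℝ) j, 0 ≤ gapk m k η j := fun η j => le_max_right _ _
  set rs := rAk m k S α θ with hrs
  have hrabs : ∀ a, -R ≤ r a ∧ r a ≤ R := fun a => abs_le.mp (hj0 a)
  have hRr : R ≤ rs := by
    by_contra hlt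
    push Not at hlt
    have h1 := hacc (ihat j0)
    rw [hθ j0, sub_sub_cancel, ← hR] at h1
    have h2 : R ≤ gapk m k θ (ihat j0) / 2 := by
      rcases le_max_iff.mp h1 with h | h
      · exact absurd h (not_le.mpr hlt)
      · exact h
    have h3 : θ (ihat j0) + 2 * R ≤ kth m k θ := by
      rcases le_max_iff.mp (show 2 * R ≤ gapk m k θ (ihat j0) by linarith) with h | h <;> linarith
    have hj : ∃ j, kth m k θ ≤ θ j ∧ j ∉ Set.range ihat := by
      by_contra hno
      push Not at hno
      have hsub : {j : Fin m | kth m k θ ≤ θ j} ⊂ Set.range ihat := by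
        refine ⟨fun j hj => hno j hj, fun h => ?_⟩
        have : kth m k θ ≤ θ (ihat j0) := h ⟨j0, rfl⟩
        linarith
      have := Set.ncard_lt_ncard hsub (Set.toFinite _)
      have := kth_attained hkm θ
      omega
    obtain ⟨j, hj1, hj2⟩ := hj
    have h4 := hacc j
    have h5 : gapk m k θ j = 0 := max_eq_right (by linarith)
    rw [h5, zero_div, max_eq_left hr0] at h4
    have h6 := (abs_le.mp h4).1
    have h7 := hout j hj2 j0
    have h8 := hθ j0
    have h9 := (hrabs j0).2
    linarith
  have hkθ : xk - R ≤ kth m k θ := by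
    apply kth_ge_of hk
    rw [← hcard]
    refine Set.ncard_le_ncard ?_ (Set.toFinite _)
    rintro _ ⟨a, rfl⟩
    have := hxk_le a
    have := (hrabs a).2
    simp only [Set.mem_ofPred_eq, hθ a]
    linarith
  set T := thetaTil m k X ihat xk R with hT
  have hTin : ∀ a, T (ihat a) = X (ihat a) - R := by
    intro a
    simp only [hT, thetaTil]
    rw [if_pos ⟨a, rfl⟩]
  have hTout : ∀ j, j ∉ Set.range ihat → T j = min (2 / 3 * X j + 1 / 3 * (xk - R)) (xk - R) := by
    intro j hj
    simp only [hT, thetaTil]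
    exact if_neg (fun ⟨a, ha⟩ => hj ⟨a, ha⟩)
  have hkT : kth m k T ≤ xk - R := by
    by_contra hlt
    push Not at hlt
    have hsub : {j : Fin m | kth m k T ≤ T j} ⊂ Set.range ihat := by
      refine ⟨fun j hj => ?_, fun h => ?_⟩
      · by_contra hj2
        have h1 := hTout j hj2
        have h2 : T j ≤ xk - R := h1 ▸ min_le_right _ _
        have h3 : kth m k T ≤ T j := hj
        linarith
      · have h1 : kth m k T ≤ T (ihat last) := h ⟨last, rfl⟩
        rw [hTin] at h1
        linarith
    have := Set.ncard_lt_ncard hsub (Set.toFinite _)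
    have := kth_attained hkm T
    omega
  have hcmp : ∀ j, gapk m k T j / 2 < rs ∨ gapk m k T j / 2 ≤ gapk m k θ j / 2 := by
    intro j
    have hg := hgap0 θ j
    by_cases hj : j ∈ Set.range ihat
    · right
      obtain ⟨a, rfl⟩ := hj
      have h1 : gapk m k T (ihat a) = 0 := by
        refine max_eq_right ?_
        rw [hTin]
        have := hxk_le a
        linarith
      rw [h1]; linarith
    · have h1 : gapk m k T j ≤ max (2 / 3 * (xk - R - X j)) 0 := by
        have h2 := hTout j hj
        refine max_le ?_ (le_max_right _ _)
        rcases min_choice (2 / 3 * X j + 1 / 3 * (xk - R)) (xk - R) with h | h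
        · exact le_max_of_le_left (by rw [h2, h]; linarith)
        · exact le_max_of_le_right (by rw [h2, h]; linarith)
      have h3 : kth m k θ - θ j ≤ gapk m k θ j := le_max_left _ _
      have h4 := (abs_le.mp (hacc j)).1
      rcases le_max_iff.mp h1 with h | h
      · by_cases hc : rs ≤ gapk m k θ j / 2
        · right
          rw [max_eq_right hc] at h4
          linarith
        · left
          push Not at hc
          rw [max_eq_left hc.le] at h4
          linarith
      · right; linarith
  have hne : {ρ : ℝ | 0 ≤ ρ ∧ S (fun j => max ρ (gapk m k T j / 2)) ≤ α}.Nonempty := by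
    obtain ⟨M, hM⟩ := hSlim α hα0
    exact ⟨max M 0, le_max_right _ _,
      (hM _ fun j => (le_max_left M 0).trans (le_max_left _ _)).le⟩
  refine le_csInf hne ?_
  rintro ρ ⟨hρ0, hρ⟩
  by_contra hlt
  push Not at hlt
  have hev : ∀ᶠ q in nhdsWithin rs (Set.Iio rs),
      ∀ j, gapk m k T j / 2 < rs → gapk m k T j / 2 < q := by
    rw [Filter.eventually_all]
    intro j
    by_cases hj : gapk m k T j / 2 < rs
    · have h2 : ∀ᶠ q in nhdsWithin rs (Set.Iio rs), gapk m k T j / 2 < q :=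
        (lt_mem_nhds hj).filter_mono nhdsWithin_le_nhds
      filter_upwards [h2] with q hq _ using hq
    · exact Filter.Eventually.of_forall fun _ h => absurd h hj
  have hev2 : ∀ᶠ q in nhdsWithin rs (Set.Iio rs), ρ < q :=
    (lt_mem_nhds (hlt.trans_le hRr)).filter_mono nhdsWithin_le_nhds
  obtain ⟨q, ⟨hq1, hq2⟩, hq3⟩ := ((hev.and hev2).and self_mem_nhdsWithin).exists
  have hq3' : q < rs := hq3
  have hle : S (fun j => max q (gapk m k θ j / 2)) ≤ α := by
    refine le_trans (S_anti S hSanti (fun j => max ρ (gapk m k T j / 2)) _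
      (fun j => le_max_of_le_left hρ0) fun j => max_le (le_max_of_le_left hq2.le) ?_) hρ
    rcases hcmp j with h | h
    · exact le_max_of_le_left (hq1 j h).le
    · exact le_max_of_le_right h
  have : rs ≤ q := csInf_le ⟨0, fun x hx => hx.1⟩ ⟨hρ0.trans hq2.le, hle⟩
  linarith
end
end

section
/- (Projection along the population winner equals projection along the empirical winner.) Suppose 𝐒 : [0,∞)^m → [0,∞) is continuous, strictly decreasing in each coordinate, tends to 0 as min_j v_j → ∞, and is symmetric in the entries of its argument: 𝐒(v) = 𝐒(v_σ) for every permutation σ of [m], where v_σ permutes the entries of v by σ. Let X ∈ ℝ^m have a unique maximizer î = argmax_j X_j. Then { max_{i∈[m]} θ_i : θ ∈ ℝ^m, X ∈ A_α(θ) } = { θ_î : θ ∈ ℝ^m, X ∈ A_α(θ) }; i.e., the sets obtained by inverting the zoom test and projecting along the population-winner value θ* and along the empirical winner coordinate î coincide. -/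
open Set

noncomputable section

/-- Suboptimality gap `Δ_j(θ) = max_i θ_i − θ_j`. -/
def gapv {m : ℕ} (θ : Fin m → ℝ) (j : Fin m) : ℝ := (⨆ i, θ i) - θ j

/-- Active radius `r_α(θ) = min {r ≥ 0 : 𝐒((max{r, Δ_j(θ)/2})_j) ≤ α}`. -/
def rA {m : ℕ} (S : (Fin m → ℝ) → ℝ) (α : ℝ) (θ : Fin m → ℝ) : ℝ :=
  sInf {r : ℝ | 0 ≤ r ∧ S (fun j => max r (gapv θ j / 2)) ≤ α}

/-- Acceptance-region membership: `x ∈ A_α(θ)`. -/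
def accept {m : ℕ} (S : (Fin m → ℝ) → ℝ) (α : ℝ) (θ x : Fin m → ℝ) : Prop :=
  ∀ j, |x j - θ j| ≤ max (rA S α θ) (gapv θ j / 2)

lemma aux_anti {m : ℕ} (S : (Fin m → ℝ) → ℝ)
    (hSanti : ∀ v : Fin m → ℝ, (∀ j, 0 ≤ v j) → ∀ (j : Fin m) (a b : ℝ),
      0 ≤ a → a < b → S (Function.update v j b) < S (Function.update v j a))
    (v w : Fin m → ℝ) (hv : ∀ j, 0 ≤ v j) (hvw : ∀ j, v j ≤ w j) : S w ≤ S v := by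
  classical
  have key : ∀ s : Finset (Fin m), S (fun j => if j ∈ s then w j else v j) ≤ S v := by
    intro s
    induction s using Finset.induction_on with
    | empty => simp
    | insert a s ha hs =>
      refine le_trans ?_ hs
      set u : Fin m → ℝ := fun j => if j ∈ s then w j else v j with hu
      have hu0 : ∀ j, 0 ≤ u j := by
        intro j
        simp only [hu]
        split_ifs
        · exact (hv j).trans (hvw j)
        · exact hv j
      have h1 : (fun j => if j ∈ insert a s then w j else v j) = Function.update u a (w a) := by
        funext j
        by_cases hj : j = a
        · subst hj; simp
        · simp [hj, hu]
      have h2 : u = Function.update u a (v a) := by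
        funext j
        by_cases hj : j = a
        · subst hj; simp [hu, ha]
        · simp [hj]
      rw [h1]
      rcases (hvw a).eq_or_lt with h | h
      · rw [← h, ← h2]
      · have := hSanti u hu0 a (v a) (w a) (hv a) h
        rw [← h2] at this
        exact this.le
  simpa using key Finset.univ

lemma aux_nonneg {m : ℕ} (S : (Fin m → ℝ) → ℝ) (α : ℝ) (θ : Fin m → ℝ) : 0 ≤ rA S α θ :=
  Real.sInf_nonneg (fun _ hr => hr.1)

lemma aux_le {m : ℕ} (θ : Fin m → ℝ) (j : Fin m) : θ j ≤ ⨆ i, θ i :=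
  le_ciSup (Set.finite_range θ).bddAbove j

lemma aux_mono {m : ℕ} (S : (Fin m → ℝ) → ℝ) (α : ℝ) (hα0 : 0 < α)
    (hSanti : ∀ v : Fin m → ℝ, (∀ j, 0 ≤ v j) → ∀ (j : Fin m) (a b : ℝ),
      0 ≤ a → a < b → S (Function.update v j b) < S (Function.update v j a))
    (hSlim : ∀ ε : ℝ, 0 < ε → ∃ M : ℝ, ∀ v : Fin m → ℝ, (∀ j, M ≤ v j) → S v < ε)
    (θ θ' : Fin m → ℝ) (h : ∀ j, gapv θ' j ≤ gapv θ j) : rA S α θ ≤ rA S α θ' := by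
  apply csInf_le_csInf
  · exact ⟨0, fun r hr => hr.1⟩
  · obtain ⟨M, hM⟩ := hSlim α hα0
    exact ⟨max M 0, le_max_right _ _,
      (hM _ fun j => (le_max_left M 0).trans (le_max_left _ _)).le⟩
  · rintro r ⟨hr, hS⟩
    refine ⟨hr, le_trans (aux_anti S hSanti _ _ ?_ ?_) hS⟩
    · exact fun j => hr.trans (le_max_left _ _)
    · exact fun j => max_le_max le_rfl (by linarith [h j])

/-- **Projection along the population winner equals projection along the
empirical winner.** For symmetric `𝐒` and `X` with unique maximizer `î`,
`{max_i θ_i : X ∈ A_α(θ)} = {θ_î : X ∈ A_α(θ)}`. -/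
theorem population_winner_projection
    (m : ℕ) (hm : 0 < m) (α : ℝ) (hα0 : 0 < α) (hα1 : α < 1)
    (S : (Fin m → ℝ) → ℝ)
    (hS0 : ∀ v : Fin m → ℝ, (∀ j, 0 ≤ v j) → 0 ≤ S v)
    (hScont : ContinuousOn S {v : Fin m → ℝ | ∀ j, 0 ≤ v j})
    (hSanti : ∀ v : Fin m → ℝ, (∀ j, 0 ≤ v j) → ∀ (j : Fin m) (a b : ℝ),
      0 ≤ a → a < b → S (Function.update v j b) < S (Function.update v j a))
    (hSlim : ∀ ε : ℝ, 0 < ε → ∃ M : ℝ, ∀ v : Fin m → ℝ, (∀ j, M ≤ v j) → S v < ε)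
    (hSsym : ∀ (σ : Equiv.Perm (Fin m)) (v : Fin m → ℝ), S (v ∘ σ) = S v)
    (X : Fin m → ℝ) (ih : Fin m) (hih : ∀ j, j ≠ ih → X j < X ih) :
    {s : ℝ | ∃ θ : Fin m → ℝ, accept S α θ X ∧ s = ⨆ i, θ i} =
    {s : ℝ | ∃ θ : Fin m → ℝ, accept S α θ X ∧ s = θ ih} := by
  haveI : Nonempty (Fin m) := ⟨⟨0, hm⟩⟩
  have hXle : ∀ j, X j ≤ X ih := fun j => by
    by_cases h : j = ih
    · rw [h]
    · exact (hih j h).le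
  ext s
  constructor
  · rintro ⟨θ, hacc, rfl⟩
    obtain ⟨k, hk⟩ := exists_eq_ciSup_of_finite (f := θ)
    have hr := aux_nonneg S α θ
    set σ := Equiv.swap k ih with hσ
    have hsup : (⨆ i, (θ ∘ σ) i) = ⨆ i, θ i := σ.iSup_comp (g := θ)
    have hgap : ∀ j, gapv (θ ∘ σ) j = gapv θ (σ j) := by
      intro j; simp only [gapv, hsup]; rfl
    have hrA : rA S α (θ ∘ σ) = rA S α θ := by
      unfold rA
      congr 1
      ext r
      have : S (fun j => max r (gapv (θ ∘ σ) j / 2)) = S (fun j => max r (gapv θ j / 2)) := by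
        rw [← hSsym σ (fun j => max r (gapv θ j / 2))]
        congr 1
        funext j
        simp [hgap]
      simp only [Set.mem_setOf_eq, this]
    refine ⟨θ ∘ σ, ?_, ?_⟩
    · have hak := hacc k
      have hai := hacc ih
      have hle := aux_le θ ih
      have hX := hXle k
      have gk : gapv θ k = 0 := by simp [gapv, hk]
      have gi : gapv θ ih = θ k - θ ih := by simp [gapv, hk]
      rw [← hk] at hle
      intro j
      rw [hrA, hgap]
      rw [gk, zero_div, max_eq_left hr, abs_le] at hak
      by_cases hj : j = ih
      · subst hj
        simp only [hσ, Function.comp, Equiv.swap_apply_right, gk, zero_div, max_eq_left hr]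
        rw [abs_le] at hai ⊢
        rw [gi] at hai
        rcases le_total (rA S α θ) ((θ k - θ j) / 2) with h | h
        · rw [max_eq_right h] at hai
          constructor <;> linarith
        · rw [max_eq_left h] at hai
          constructor <;> linarith
      · by_cases hj' : j = k
        · subst hj'
          simp only [hσ, Function.comp, Equiv.swap_apply_left]
          rw [abs_le] at hai ⊢
          have := le_max_left (rA S α θ) (gapv θ ih / 2)
          constructor <;> linarith
        · simp only [hσ, Function.comp, Equiv.swap_apply_of_ne_of_ne hj' hj]
          exact hacc j
    · simp [hσ, hk]
  · rintro ⟨θ, hacc, rfl⟩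
    obtain ⟨k, hk⟩ := exists_eq_ciSup_of_finite (f := θ)
    have hr := aux_nonneg S α θ
    have hg0 : ∀ j, 0 ≤ gapv θ j := fun j => sub_nonneg.2 (aux_le θ j)
    have hXi : |X ih - θ ih| ≤ rA S α θ := by
      have hak := hacc k
      have hai := hacc ih
      have hX := hXle k
      have gk : gapv θ k = 0 := by simp [gapv, hk]
      have gi : gapv θ ih = θ k - θ ih := by simp [gapv, hk]
      rw [gk, zero_div, max_eq_left hr, abs_le] at hak
      rw [gi, abs_le] at hai
      rw [abs_le]
      rcases le_total (rA S α θ) ((θ k - θ ih) / 2) with h | h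
      · rw [max_eq_right h] at hai
        constructor <;> linarith
      · rwa [max_eq_left h] at hai
    classical
    set θ' : Fin m → ℝ := fun j =>
      if j = ih then θ ih else min (θ ih) (max (X j) (θ ih - gapv θ j)) with hθ'
    have hi' : θ' ih = θ ih := by simp [hθ']
    have hsup : (⨆ i, θ' i) = θ ih := by
      apply le_antisymm
      · apply ciSup_le
        intro j
        simp only [hθ']
        split_ifs
        · exact le_rfl
        · exact min_le_left _ _
      · rw [← hi']; exact aux_le θ' ih
    have hgap : ∀ j, gapv θ' j = θ ih - θ' j := fun j => by simp only [gapv, hsup]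
    have hgle : ∀ j, gapv θ' j ≤ gapv θ j := by
      intro j
      rw [hgap]
      by_cases hj : j = ih
      · rw [hj, hi', sub_self]; exact hg0 _
      · simp only [hθ', if_neg hj]
        have : θ ih - gapv θ j ≤ min (θ ih) (max (X j) (θ ih - gapv θ j)) :=
          le_min (by linarith [hg0 j]) (le_max_right _ _)
        linarith
    have hrr := aux_mono S α hα0 hSanti hSlim θ θ' hgle
    refine ⟨θ', ?_, hsup.symm⟩
    intro j
    by_cases hj : j = ih
    · rw [hj, hi']
      exact (hXi.trans hrr).trans (le_max_left _ _)
    · have hv : θ' j = min (θ ih) (max (X j) (θ ih - gapv θ j)) := by simp only [hθ', if_neg hj]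
      rcases le_total (θ ih) (X j) with h | h
      · have : θ' j = θ ih := by
          rw [hv]; exact min_eq_left (h.trans (le_max_left _ _))
        rw [this]
        refine le_trans ?_ (le_max_left _ _)
        rw [abs_le] at hXi ⊢
        have := hXle j
        constructor <;> linarith
      · rcases le_total (θ ih - gapv θ j) (X j) with h2 | h2
        · have : θ' j = X j := by rw [hv, max_eq_left h2, min_eq_right h]
          rw [this, sub_self, abs_zero]
          exact (hr.trans hrr).trans (le_max_left _ _)
        · have he : θ' j = θ ih - gapv θ j := by
            rw [hv, max_eq_right h2, min_eq_right (by linarith [hg0 j])]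
          have hge : gapv θ' j = gapv θ j := by rw [hgap, he]; ring
          rw [hge]
          refine le_trans ?_ (max_le_max_right (gapv θ j / 2) hrr)
          have ha := hacc j
          have hM := aux_le θ ih
          have hd : θ j = (⨆ i, θ i) - gapv θ j := by simp [gapv]
          have hm0 := hr.trans (le_max_left (rA S α θ) (gapv θ j / 2))
          rw [he]
          rw [abs_le] at ha ⊢
          constructor <;> linarith
end
end
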